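/- Let L be a frame. Then L is infinitely De Morgan (IDM) if and only if the double-pseudocomplement map a ↦ a** preserves arbitrary infima and arbitrary suprema, i.e. (⨅ᵢ aᵢ)** = ⨅ᵢ aᵢ** and (⨆ᵢ aᵢ)** = ⨆ᵢ aᵢ** for every indexed family {aᵢ} in L. -/

import Mathlib

universe u

theorem Order.Frame.compl_iSup {L : Type*} [Order.Frame L] {ι : Sort*} (a : ι → L) :
    (⨆ i, a i)ᶜ = ⨅ i, (a i)ᶜ := by
  simp only [← himp_bot, iSup_himp_eq]

theorem Order.Frame.iSup_compl_le_compl_iInf {L : Type*} [Order.Frame L] {ι : Sort*}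
    (a : ι → L) : ⨆ i, (a i)ᶜ ≤ (⨅ i, a i)ᶜ :=
  iSup_le fun i => compl_le_compl (iInf_le a i)

/-- A frame is IDM iff the double-pseudocomplement map preserves arbitrary
infima and arbitrary suprema (i.e. it is a complete Heyting algebra homomorphism). -/
theorem idm_iff_biCompl_preserves_iInf_iSup {L : Type u} [Order.Frame L] :
    (∀ {ι : Type u} (a : ι → L), (⨅ i, a i)ᶜ ≤ ⨆ i, (a i)ᶜ) ↔
      ((∀ {ι : Type u} (a : ι → L), (⨅ i, a i)ᶜᶜ = ⨅ i, (a i)ᶜᶜ) ∧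
        (∀ {ι : Type u} (a : ι → L), (⨆ i, a i)ᶜᶜ = ⨆ i, (a i)ᶜᶜ)) := by
  constructor
  · intro h
    have compl_iInf {ι : Type u} (a : ι → L) : (⨅ i, a i)ᶜ = ⨆ i, (a i)ᶜ :=
      (h a).antisymm (Order.Frame.iSup_compl_le_compl_iInf a)
    exact ⟨fun a => by rw [compl_iInf, Order.Frame.compl_iSup],
      fun a => by rw [Order.Frame.compl_iSup, compl_iInf]⟩
  · rintro ⟨hInf, hSup⟩ ι a
    calc (⨅ i, a i)ᶜ = (⨅ i, (a i)ᶜᶜ)ᶜ := by rw [← hInf, compl_compl_compl]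
      _ = ⨆ i, (a i)ᶜᶜᶜ := by rw [← Order.Frame.compl_iSup, hSup]
      _ ≤ ⨆ i, (a i)ᶜ := by simp only [compl_compl_compl, le_refl]
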